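/- arXiv:1007.1851 — 2 statements merged into one kernel-verified Lean document; each statement's English description precedes it below -/
import Mathlib

section
/- Let B:[0,∞)→ℝ be continuous with support contained in [0,R] for some R<∞, let b(r)=∫₀^r B(t) t dt be the flux function, let α be the total flux (α=b(r) for r>R), and assume b is not identically zero. Then there exists a positive radial function h∈C²(ℝ²) such that 𝒜h=0. Moreover, any positive radial C² function h with 𝒜h=0 satisfies: if α≠0 there exist constants 0<c≤C such that c|x|^{|α|} ≤ h(x) ≤ C|x|^{|α|} for all |x|>R; if α=0 there exist constants 0<c≤C such that c(1+|log|x||) ≤ h(x) ≤ C(1+|log|x||) for all |x|>R. -/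
noncomputable section

open MeasureTheory Filter Set

abbrev E2 := EuclideanSpace ℝ (Fin 2)

def pdC (i : Fin 2) (f : E2 → ℂ) (x : E2) : ℂ :=
  fderiv ℝ f x (EuclideanSpace.single i 1)

def lapC (f : E2 → ℂ) (x : E2) : ℂ := pdC 0 (pdC 0 f) x + pdC 1 (pdC 1 f) x

def pdR (i : Fin 2) (f : E2 → ℝ) (x : E2) : ℝ :=
  fderiv ℝ f x (EuclideanSpace.single i 1)

def lapR (f : E2 → ℝ) (x : E2) : ℝ := pdR 0 (pdR 0 f) x + pdR 1 (pdR 1 f) x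

/-- The azimuthal vector potential generated by the flux function `b`. -/
def avec (b : ℝ → ℝ) (x : E2) (i : Fin 2) : ℝ :=
  (b ‖x‖ / ‖x‖ ^ 2) * (if i = 0 then -(x 1) else x 0)

/-- The magnetic Schrödinger differential expression `(i∇+A)²`. -/
def magOp (b : ℝ → ℝ) (f : E2 → ℂ) (x : E2) : ℂ :=
  - lapC f x
    + 2 * Complex.I * ((avec b x 0 : ℂ) * pdC 0 f x + (avec b x 1 : ℂ) * pdC 1 f x)
    + (((b ‖x‖) ^ 2 / ‖x‖ ^ 2 : ℝ) : ℂ) * f x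

/-- The Schrödinger differential expression `−Δ + b(|x|)²/|x|²`. -/
def schrOp (b : ℝ → ℝ) (f : E2 → ℝ) (x : E2) : ℝ :=
  - lapR f x + ((b ‖x‖) ^ 2 / ‖x‖ ^ 2) * f x

def fluxFun (B : ℝ → ℝ) (r : ℝ) : ℝ := ∫ s in (0:ℝ)..r, B s * s

structure IsMagneticHeatKernel (b : ℝ → ℝ) (K : ℝ → E2 → E2 → ℂ) : Prop where
  continuity : ∀ y, ContinuousOn (fun p : ℝ × E2 => K p.1 p.2 y) (Ioi 0 ×ˢ univ)
  symm : ∀ t x y, K t y x = starRingEnd ℂ (K t x y)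
  semigroup : ∀ s t : ℝ, 0 < s → 0 < t → ∀ x y,
    K (s + t) x y = ∫ z, K s x z * K t z y
  heat_eq : ∀ t, 0 < t → ∀ y, ∀ x : E2, x ≠ 0 →
    HasDerivAt (fun s => K s x y) (- magOp b (fun z => K t z y) x) t
  init : ∀ f : E2 → ℂ, Continuous f → HasCompactSupport f → ∀ x,
    Tendsto (fun t => ∫ y, K t x y * f y) (nhdsWithin 0 (Ioi 0)) (nhds (f x))

structure IsSchrodingerHeatKernel (b : ℝ → ℝ) (K : ℝ → E2 → E2 → ℝ) : Prop where
  continuity : ∀ y, ContinuousOn (fun p : ℝ × E2 => K p.1 p.2 y) (Ioi 0 ×ˢ univ)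
  symm : ∀ t x y, K t y x = K t x y
  semigroup : ∀ s t : ℝ, 0 < s → 0 < t → ∀ x y,
    K (s + t) x y = ∫ z, K s x z * K t z y
  heat_eq : ∀ t, 0 < t → ∀ y, ∀ x : E2, x ≠ 0 →
    HasDerivAt (fun s => K s x y) (- schrOp b (fun z => K t z y) x) t
  init : ∀ f : E2 → ℝ, Continuous f → HasCompactSupport f → ∀ x,
    Tendsto (fun t => ∫ y, K t x y * f y) (nhdsWithin 0 (Ioi 0)) (nhds (f x))

structure IsRadialHeatKernel (V : ℝ → ℝ) (p : ℝ → ℝ → ℝ → ℝ) : Prop where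
  symm : ∀ t r r', p t r' r = p t r r'
  semigroup : ∀ s t : ℝ, 0 < s → 0 < t → ∀ r r'', 0 < r → 0 < r'' →
    p (s + t) r r'' = ∫ r' in Ioi (0:ℝ), p s r r' * p t r' r'' * r'
  heat_eq : ∀ t, 0 < t → ∀ r', 0 < r' → ∀ r, 0 < r →
    HasDerivAt (fun s => p s r r')
      (deriv (deriv (fun ρ => p t ρ r')) r + (1 / r) * deriv (fun ρ => p t ρ r') r
        - V r * p t r r') t
  init : ∀ f : ℝ → ℝ, Continuous f → HasCompactSupport f → tsupport f ⊆ Ioi 0 →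
    ∀ r, 0 < r →
      Tendsto (fun t => ∫ r' in Ioi (0:ℝ), p t r r' * f r' * r')
        (nhdsWithin 0 (Ioi 0)) (nhds (f r))

/-- The modified Bessel function of the first kind. -/
def besselI (ν : ℝ) (z : ℝ) : ℝ :=
  ∑' k : ℕ, (z / 2) ^ (ν + 2 * k) / (Nat.factorial k * Real.Gamma (ν + k + 1))

def polar (r θ : ℝ) : E2 :=
  (EuclideanSpace.equiv (Fin 2) ℝ).symm ![r * Real.cos θ, r * Real.sin θ]


def Zop (m f : ℝ → ℝ) (t : ℝ) : ℝ := ∫ τ in (0:ℝ)..1, τ * (m (t * τ) * f (t * τ))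
def Sop (m f : ℝ → ℝ) (ρ : ℝ) : ℝ := ρ ^ 2 * ∫ s in (0:ℝ)..1, s * Zop m f (ρ * s)

lemma Zop_cont {m f : ℝ → ℝ} (hm : Continuous m) (hf : Continuous f) : Continuous (Zop m f) := by
  unfold Zop
  exact intervalIntegral.continuous_parametric_intervalIntegral_of_continuous' (by fun_prop) 0 1

lemma Sop_cont {m f : ℝ → ℝ} (hm : Continuous m) (hf : Continuous f) : Continuous (Sop m f) := by
  have hz := Zop_cont hm hf
  unfold Sop
  exact (continuous_pow 2).mul
    (intervalIntegral.continuous_parametric_intervalIntegral_of_continuous' (by fun_prop) 0 1)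

/-- scaling: t² ∫₀¹ τ f(tτ) = ∫₀ᵗ σ f σ -/
lemma scale_int (f : ℝ → ℝ) (t : ℝ) :
    t ^ 2 * ∫ τ in (0:ℝ)..1, τ * f (t * τ) = ∫ σ in (0:ℝ)..t, σ * f σ := by
  have h := intervalIntegral.mul_integral_comp_mul_left (a := 0) (b := 1) (f := fun σ => σ * f σ) (c := t)
  simp only [mul_zero, mul_one] at h
  rw [← h, pow_two, mul_assoc, ← intervalIntegral.integral_const_mul (r := t)]
  congr 1
  apply intervalIntegral.integral_congr
  intro x _
  simp only []
  ring

lemma Zop_nonneg {m f : ℝ → ℝ} (hm0 : ∀ x, 0 ≤ m x) (hf0 : ∀ x, 0 ≤ f x) (t : ℝ) :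
    0 ≤ Zop m f t := by
  apply intervalIntegral.integral_nonneg (by norm_num)
  intro u hu
  exact mul_nonneg hu.1 (mul_nonneg (hm0 _) (hf0 _))

lemma Sop_nonneg {m f : ℝ → ℝ} (hm0 : ∀ x, 0 ≤ m x) (hf0 : ∀ x, 0 ≤ f x) (t : ℝ) :
    0 ≤ Sop m f t := by
  apply mul_nonneg (sq_nonneg _)
  apply intervalIntegral.integral_nonneg (by norm_num)
  intro u hu
  exact mul_nonneg hu.1 (Zop_nonneg hm0 hf0 _)

lemma Zop_sub {m f g : ℝ → ℝ} (hm : Continuous m) (hf : Continuous f) (hg : Continuous g) (t : ℝ) :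
    Zop m (fun x => f x - g x) t = Zop m f t - Zop m g t := by
  unfold Zop
  rw [← intervalIntegral.integral_sub
    (Continuous.intervalIntegrable (by fun_prop) _ _) (Continuous.intervalIntegrable (by fun_prop) _ _)]
  congr 1; ext x; ring

lemma Sop_sub {m f g : ℝ → ℝ} (hm : Continuous m) (hf : Continuous f) (hg : Continuous g) (t : ℝ) :
    Sop m (fun x => f x - g x) t = Sop m f t - Sop m g t := by
  have h1 := Zop_cont hm hf
  have h2 := Zop_cont hm hg
  unfold Sop
  rw [← mul_sub, ← intervalIntegral.integral_sub
    (Continuous.intervalIntegrable (by fun_prop) _ _) (Continuous.intervalIntegrable (by fun_prop) _ _)]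
  congr 2; ext x; rw [Zop_sub hm hf hg]; ring

lemma Zop_bound {m f : ℝ → ℝ} {M K : ℝ} (hm0 : ∀ x, 0 ≤ m x) (hmM : ∀ x, m x ≤ M) (hM : 1 ≤ M)
    (hK : 0 ≤ K) (hf : ∀ x, |f x| ≤ K * Real.exp (M * x ^ 2)) (t : ℝ) :
    |Zop m f t| ≤ M * K * Real.exp (M * t ^ 2) := by
  have := intervalIntegral.norm_integral_le_of_norm_le_const (a := (0:ℝ)) (b := 1)
    (f := fun τ => τ * (m (t * τ) * f (t * τ))) (C := M * K * Real.exp (M * t ^ 2)) ?_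
  · simpa [Zop] using this
  intro x hx
  rw [uIoc_of_le zero_le_one] at hx
  rw [Real.norm_eq_abs, abs_mul, abs_mul, abs_of_pos hx.1, abs_of_nonneg (hm0 _)]
  have h1 : Real.exp (M * (t * x) ^ 2) ≤ Real.exp (M * t ^ 2) := by
    apply Real.exp_le_exp.2
    have : x ^ 2 ≤ 1 := by nlinarith [hx.1, hx.2]
    rw [mul_pow]
    apply mul_le_mul_of_nonneg_left _ (by linarith)
    nlinarith [sq_nonneg t]
  have h2 := hf (t * x)
  have h3 : |f (t * x)| ≤ K * Real.exp (M * t ^ 2) := h2.trans (by gcongr)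
  calc x * (m (t * x) * |f (t * x)|) ≤ 1 * (M * (K * Real.exp (M * t ^ 2))) := by
        gcongr
        · exact mul_nonneg (hm0 _) (abs_nonneg _)
        · exact hx.2
        · exact hmM _
    _ = _ := by ring

lemma Sop_bound {m f : ℝ → ℝ} {M K : ℝ} (hm : Continuous m) (hf' : Continuous f)
    (hm0 : ∀ x, 0 ≤ m x) (hmM : ∀ x, m x ≤ M) (hM : 1 ≤ M)
    (hK : 0 ≤ K) (hf : ∀ x, |f x| ≤ K * Real.exp (M * x ^ 2)) (ρ : ℝ) :
    |Sop m f ρ| ≤ K / 2 * Real.exp (M * ρ ^ 2) := by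
  have hz := Zop_cont hm hf'
  have hd : ∀ s : ℝ, HasDerivAt (fun s => K / 2 * Real.exp (M * (ρ * s) ^ 2))
      (ρ ^ 2 * (s * (M * K * Real.exp (M * (ρ * s) ^ 2)))) s := by
    intro s
    have h1 : HasDerivAt (fun s : ℝ => M * (ρ * s) ^ 2) (M * (2 * (ρ * s) * ρ)) s := by
      have := (((hasDerivAt_id s).const_mul ρ).pow 2).const_mul M
      simpa using this
    have := h1.exp.const_mul (K / 2)
    refine this.congr_deriv ?_
    ring
  have hI := intervalIntegral.integral_eq_sub_of_hasDerivAt (a := 0) (b := 1)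
    (fun s _ => hd s) (Continuous.intervalIntegrable (by fun_prop) _ _)
  have : |∫ s in (0:ℝ)..1, ρ ^ 2 * (s * Zop m f (ρ * s))| ≤
      ∫ s in (0:ℝ)..1, ρ ^ 2 * (s * (M * K * Real.exp (M * (ρ * s) ^ 2))) := by
    rw [← Real.norm_eq_abs]
    apply intervalIntegral.norm_integral_le_of_norm_le zero_le_one
    · refine Eventually.of_forall fun s hs => ?_
      rw [Real.norm_eq_abs, abs_mul, abs_mul, abs_of_pos hs.1, abs_of_nonneg (sq_nonneg ρ)]
      have := Zop_bound hm0 hmM hM hK hf (ρ * s)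
      have := hs.1.le
      gcongr
    · exact Continuous.intervalIntegrable (by fun_prop) _ _
  rw [hI] at this
  unfold Sop
  rw [← intervalIntegral.integral_const_mul]
  refine this.trans ?_
  simp
  linarith

lemma exists_fix {m : ℝ → ℝ} {M : ℝ} (hm : Continuous m)
    (hm0 : ∀ x, 0 ≤ m x) (hmM : ∀ x, m x ≤ M) (hM : 1 ≤ M) :
    ∃ G : ℝ → ℝ, Continuous G ∧ (∀ ρ, G ρ = 1 + Sop m G ρ) ∧ ∀ ρ, 0 < G ρ := by
  let W : BoundedContinuousFunction ℝ ℝ → ℝ → ℝ := fun v x => Real.exp (M * x ^ 2) * v x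
  have hWc : ∀ v, Continuous (W v) := fun v => by
    have := v.continuous
    simp only [W]; fun_prop
  have hWb : ∀ v x, |W v x| ≤ ‖v‖ * Real.exp (M * x ^ 2) := fun v x => by
    simp only [W]
    rw [abs_mul, abs_of_pos (Real.exp_pos _), mul_comm]
    have := v.norm_coe_le_norm x
    rw [Real.norm_eq_abs] at this
    gcongr
  have hexp : ∀ x : ℝ, Real.exp (-(M * x ^ 2)) * Real.exp (M * x ^ 2) = 1 := fun x => by
    rw [← Real.exp_add]; simp
  let T : BoundedContinuousFunction ℝ ℝ → BoundedContinuousFunction ℝ ℝ := fun v =>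
    BoundedContinuousFunction.ofNormedAddCommGroup
      (fun x => Real.exp (-(M * x ^ 2)) * (1 + Sop m (W v) x))
      (by have := Sop_cont hm (hWc v); fun_prop) (1 + ‖v‖ / 2) (by
        intro x
        have h1 := Sop_bound hm (hWc v) hm0 hmM hM (norm_nonneg v) (hWb v) x
        rw [Real.norm_eq_abs, abs_mul, abs_of_pos (Real.exp_pos _)]
        have h2 : |1 + Sop m (W v) x| ≤ 1 + ‖v‖ / 2 * Real.exp (M * x ^ 2) := by
          refine (abs_add_le _ _).trans ?_
          simpa using h1
        have h3 : Real.exp (-(M * x ^ 2)) ≤ 1 := Real.exp_le_one_iff.2 (by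
          have : 0 ≤ M * x ^ 2 := by positivity
          linarith)
        calc _ ≤ Real.exp (-(M * x ^ 2)) * (1 + ‖v‖ / 2 * Real.exp (M * x ^ 2)) := by gcongr
          _ = Real.exp (-(M * x ^ 2)) + ‖v‖ / 2 * (Real.exp (-(M * x ^ 2)) * Real.exp (M * x ^ 2)) := by ring
          _ ≤ _ := by rw [hexp]; linarith)
  have hT : ∀ v x, T v x = Real.exp (-(M * x ^ 2)) * (1 + Sop m (W v) x) := fun v x => rfl
  have hc : ContractingWith (1/2) T := by
    refine ⟨by rw [← NNReal.coe_lt_coe]; norm_num, ?_⟩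
    refine LipschitzWith.of_dist_le_mul fun v w => ?_
    rw [BoundedContinuousFunction.dist_le (by positivity)]
    intro x
    rw [Real.dist_eq, hT, hT, ← mul_sub, add_sub_add_left_eq_sub, ← Sop_sub hm (hWc v) (hWc w)]
    have h1 := Sop_bound (f := fun y => W v y - W w y) hm ((hWc v).sub (hWc w)) hm0 hmM hM
      (norm_nonneg (v - w)) (fun y => by
        have := hWb (v - w) y
        simpa [W, mul_sub] using this) x
    rw [abs_mul, abs_of_pos (Real.exp_pos _), dist_eq_norm]
    calc _ ≤ Real.exp (-(M * x ^ 2)) * (‖v - w‖ / 2 * Real.exp (M * x ^ 2)) := by gcongr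
      _ = ‖v - w‖ / 2 * (Real.exp (-(M * x ^ 2)) * Real.exp (M * x ^ 2)) := by ring
      _ ≤ _ := by rw [hexp]; simp; linarith
  have hpos : ∀ n x, 0 ≤ (T^[n] 0) x := by
    intro n
    induction n with
    | zero => intro x; simp
    | succ n ih =>
      intro x
      rw [Function.iterate_succ_apply', hT]
      have := Sop_nonneg (f := W (T^[n] 0)) hm0 (fun y => mul_nonneg (Real.exp_pos _).le (ih y)) x
      positivity
  set v := hc.fixedPoint T with hv
  have hfix : T v = v := hc.fixedPoint_isFixedPt
  have hvpos : ∀ x, 0 ≤ v x := by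
    intro x
    have h1 := hc.tendsto_iterate_fixedPoint 0
    have h2 : Tendsto (fun n => (T^[n] 0) x) atTop (nhds (v x)) :=
      ((continuous_eval_const (F := BoundedContinuousFunction ℝ ℝ) x).tendsto _).comp h1
    exact ge_of_tendsto' h2 (fun n => hpos n x)
  have hG : ∀ ρ, W v ρ = 1 + Sop m (W v) ρ := by
    intro ρ
    have : W v ρ = Real.exp (M * ρ ^ 2) * T v ρ := by rw [hfix]
    rw [this, hT, ← mul_assoc, mul_comm (Real.exp _), hexp, one_mul]
  refine ⟨W v, hWc v, hG, fun ρ => ?_⟩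
  rw [hG]
  have := Sop_nonneg (f := W v) hm0 (fun y => mul_nonneg (Real.exp_pos _).le (hvpos y)) ρ
  linarith

lemma exists_G {m : ℝ → ℝ} {M : ℝ} (hm : Continuous m)
    (hm0 : ∀ x, 0 ≤ m x) (hmM : ∀ x, m x ≤ M) (hM : 1 ≤ M) :
    ∃ G G1 G2 : ℝ → ℝ, (∀ ρ, HasDerivAt G (G1 ρ) ρ) ∧ (∀ ρ, HasDerivAt G1 (G2 ρ) ρ) ∧
      Continuous G2 ∧ (∀ ρ, ρ * G2 ρ + G1 ρ = ρ * m ρ * G ρ) ∧ ∀ ρ, 0 < G ρ := by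
  obtain ⟨G, hGc, hG, hpos⟩ := exists_fix hm hm0 hmM hM
  have hz := Zop_cont hm hGc
  refine ⟨G, fun t => t * Zop m G t, fun t => m t * G t - Zop m G t, ?_, ?_, by fun_prop,
    fun ρ => by ring, hpos⟩
  · intro ρ
    have h1 : G = fun ρ => 1 + ∫ s in (0:ℝ)..ρ, s * Zop m G s := by
      ext x
      rw [hG x, Sop, scale_int]
    have h2 : HasDerivAt (fun ρ => 1 + ∫ s in (0:ℝ)..ρ, s * Zop m G s) (ρ * Zop m G ρ) ρ :=
      ((Continuous.integral_hasStrictDerivAt (f := fun s => s * Zop m G s) (by fun_prop) 0 ρ).hasDerivAt).const_add 1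
    rwa [← h1] at h2
  · have key : ∀ t, t ≠ 0 → HasDerivAt (fun t => t * Zop m G t) (m t * G t - Zop m G t) t := by
      intro t ht
      have h2 : HasDerivAt (fun ρ => ∫ s in (0:ℝ)..ρ, s * (m s * G s)) (t * (m t * G t)) t :=
        ((Continuous.integral_hasStrictDerivAt (f := fun s => s * (m s * G s)) (by fun_prop) 0 t).hasDerivAt)
      have e : ∀ t, ∫ s in (0:ℝ)..t, s * (m s * G s) = t ^ 2 * Zop m G t := fun t => by
        rw [Zop, scale_int (fun s => m s * G s)]
      have h3 := h2.div (hasDerivAt_id t) ht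
      have h4 : HasDerivAt (fun t => t * Zop m G t) _ t := h3.congr_of_eventuallyEq (by
        filter_upwards [isOpen_ne.mem_nhds ht] with s hs
        have hs : s ≠ 0 := hs
        simp only [Pi.div_apply, e, id]
        field_simp)
      convert h4 using 1
      simp only [e, id]
      field_simp
    intro t
    by_cases ht : t = 0
    · subst ht
      exact hasDerivAt_of_hasDerivAt_of_ne (f := fun t => t * Zop m G t) (g := fun t => m t * G t - Zop m G t)
        (fun y hy => key y hy) (by fun_prop) (by fun_prop)
    · exact key t ht

lemma pd_radial (G : ℝ → ℝ) (g1 : ℝ) (x : E2) (i : Fin 2) (h1 : HasDerivAt G g1 (‖x‖ ^ 2)) :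
    HasFDerivAt (fun y : E2 => G (‖y‖ ^ 2)) (g1 • ((2:ℝ) • innerSL ℝ x)) x := by
  have h := (hasStrictFDerivAt_norm_sq x).hasFDerivAt
  have := h1.comp_hasFDerivAt x h
  refine (this.congr_fderiv ?_ : HasFDerivAt (G ∘ fun y : E2 => ‖y‖ ^ 2) _ x)
  ext v
  simp

lemma lap_radial (G G1 : ℝ → ℝ) (g2 : ℝ) (x : E2)
    (h1 : ∀ᶠ ρ in nhds (‖x‖ ^ 2), HasDerivAt G (G1 ρ) ρ)
    (h2 : HasDerivAt G1 g2 (‖x‖ ^ 2)) :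
    lapR (fun y : E2 => G (‖y‖ ^ 2)) x = 4 * (‖x‖ ^ 2 * g2 + G1 (‖x‖ ^ 2)) := by
  have hc : Tendsto (fun y : E2 => ‖y‖ ^ 2) (nhds x) (nhds (‖x‖ ^ 2)) := by
    apply Continuous.tendsto; fun_prop
  have e : ∀ i, pdR i (fun y : E2 => G (‖y‖ ^ 2)) =ᶠ[nhds x]
      fun y => G1 (‖y‖ ^ 2) * (2 * y i) := by
    intro i
    filter_upwards [hc.eventually h1] with y hy
    rw [pdR, (pd_radial G _ y i hy).fderiv]
    simp [EuclideanSpace.inner_single_right]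
  have e2 : ∀ i, pdR i (pdR i (fun y : E2 => G (‖y‖ ^ 2))) x =
      g2 * (2 * x i) * (2 * x i) + G1 (‖x‖ ^ 2) * 2 := by
    intro i
    rw [pdR, (e i).fderiv_eq]
    have h3 := pd_radial G1 g2 x i h2
    have h4 : HasFDerivAt (fun y : E2 => 2 * y i) ((2:ℝ) • (EuclideanSpace.proj i : E2 →L[ℝ] ℝ)) x :=
      ((EuclideanSpace.proj i : E2 →L[ℝ] ℝ).hasFDerivAt).const_mul 2
    rw [(h3.fun_mul h4).fderiv]
    simp [EuclideanSpace.inner_single_right]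
    ring
  rw [lapR, e2, e2, EuclideanSpace.norm_sq_eq]
  simp [Fin.sum_univ_two]
  ring

/-- flux function is `r² β(r)` with `β` continuous, nonneg bounded square -/
lemma flux_beta (B : ℝ → ℝ) (r : ℝ) :
    fluxFun B r = r ^ 2 * ∫ τ in (0:ℝ)..1, τ * B (r * τ) := by
  rw [scale_int, fluxFun]
  congr 1; ext s; ring

lemma beta_cont {B : ℝ → ℝ} (hB : Continuous B) :
    Continuous fun r : ℝ => ∫ τ in (0:ℝ)..1, τ * B (r * τ) :=
  intervalIntegral.continuous_parametric_intervalIntegral_of_continuous' (by fun_prop) 0 1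

lemma part_one (B : ℝ → ℝ) (R : ℝ) (hBcont : Continuous B)
    (hBsupp : Function.support B ⊆ Icc 0 R)
    (b : ℝ → ℝ) (hb : ∀ r, b r = fluxFun B r) :
    ∃ h : E2 → ℝ, ContDiff ℝ 2 h ∧ (∀ x, 0 < h x) ∧ (∃ g : ℝ → ℝ, ∀ x, h x = g ‖x‖) ∧
        ∀ x : E2, x ≠ 0 → schrOp b h x = 0 := by
  have hcs : HasCompactSupport B :=
    HasCompactSupport.intro' isCompact_Icc isClosed_Icc
      (fun x hx => by by_contra h; exact hx (hBsupp h))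
  obtain ⟨S, hS⟩ := hcs.exists_bound_of_continuous hBcont
  have hS0 : 0 ≤ S := (norm_nonneg _).trans (hS 0)
  set β : ℝ → ℝ := fun r => ∫ τ in (0:ℝ)..1, τ * B (r * τ) with hβ
  have hβc : Continuous β := beta_cont hBcont
  have hβb : ∀ r, |β r| ≤ S := by
    intro r
    have := intervalIntegral.norm_integral_le_of_norm_le_const (a := (0:ℝ)) (b := 1)
      (f := fun τ => τ * B (r * τ)) (C := S) (fun x hx => by
        rw [uIoc_of_le zero_le_one] at hx
        rw [norm_mul, Real.norm_eq_abs x, abs_of_pos hx.1]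
        calc x * ‖B (r * x)‖ ≤ 1 * S := by
              gcongr
              · exact hx.2
              · exact hS _
          _ = S := one_mul S)
    simpa using this
  obtain ⟨G, G1, G2, hG1, hG2, hG2c, heq, hpos⟩ := exists_G (m := fun ρ => β (Real.sqrt ρ) ^ 2 / 4)
    (M := S ^ 2 / 4 + 1) (by fun_prop) (fun x => by positivity)
    (fun x => by
      have h1 := sq_le_sq' (abs_le.1 (hβb (Real.sqrt x))).1 (abs_le.1 (hβb (Real.sqrt x))).2
      linarith) (by nlinarith [sq_nonneg S])
  have hGd : ContDiff ℝ 2 G := by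
    have d1 : deriv G = G1 := funext fun x => (hG1 x).deriv
    have d2 : deriv G1 = G2 := funext fun x => (hG2 x).deriv
    have h1 : ContDiff ℝ 1 G1 := contDiff_one_iff_deriv.2
      ⟨fun x => (hG2 x).differentiableAt, by rwa [d2]⟩
    have : ContDiff ℝ (1 + 1) G := contDiff_succ_iff_deriv.2
      ⟨fun x => (hG1 x).differentiableAt, by simp, by rwa [d1]⟩
    simpa [one_add_one_eq_two] using this
  refine ⟨fun x => G (‖x‖ ^ 2), hGd.comp (contDiff_norm_sq ℝ), fun x => hpos _,
    ⟨fun r => G (r ^ 2), fun x => rfl⟩, fun x hx => ?_⟩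
  rw [schrOp, lap_radial G G1 (G2 (‖x‖ ^ 2)) x (Eventually.of_forall hG1) (hG2 _), heq, hb, flux_beta]
  have hn : ‖x‖ ≠ 0 := norm_ne_zero_iff.2 hx
  change _ + (‖x‖ ^ 2 * β ‖x‖) ^ 2 / ‖x‖ ^ 2 * _ = 0
  rw [Real.sqrt_sq (norm_nonneg x)]
  field_simp
  ring

lemma nonneg_tools (u u1 q : ℝ → ℝ) (hu1 : ∀ t, HasDerivAt u (u1 t) t)
    (hu2 : ∀ t, HasDerivAt u1 (q t ^ 2 * u t) t) (hu : ∀ t, 0 < u t)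
    (hlim : Tendsto u1 atBot (nhds 0)) (t0 : ℝ) (hq : ∃ t < t0, q t ≠ 0) : 0 < u1 t0 := by
  have hmono : Monotone u1 := monotone_of_deriv_nonneg (fun t => (hu2 t).differentiableAt)
    (fun t => by rw [(hu2 t).deriv]; have := (hu t).le; positivity)
  have hnn : ∀ t, 0 ≤ u1 t := fun t => hmono.le_of_tendsto hlim t
  by_contra hneg
  have h0 : u1 t0 = 0 := le_antisymm (not_lt.1 hneg) (hnn t0)
  obtain ⟨t, ht, hqt⟩ := hq
  have : u1 =ᶠ[nhds t] fun _ => 0 := by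
    filter_upwards [Iio_mem_nhds ht] with s hs
    exact le_antisymm (h0 ▸ hmono (le_of_lt hs)) (hnn s)
  have h1 := (hu2 t).unique ((hasDerivAt_const t (0:ℝ)).congr_of_eventuallyEq this)
  have := hu t
  have : 0 < q t ^ 2 * u t := by positivity
  linarith

/-- constancy on a half line -/
lemma const_Ici (f : ℝ → ℝ) (t0 : ℝ) (hc : Continuous f) (hf : ∀ t, t0 < t → HasDerivAt f 0 t) :
    ∀ t, t0 ≤ t → f t = f t0 := by
  intro t ht
  apply constant_of_has_deriv_right_zero (a := t0) (b := t) hc.continuousOn _ t ⟨ht, le_rfl⟩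
  intro x hx
  have key : HasDerivAt f 0 x ∨ x = t0 := by
    rcases hx.1.eq_or_lt with h | h
    · exact Or.inr h.symm
    · exact Or.inl (hf x h)
  rcases key with h | h
  · exact h.hasDerivWithinAt
  · subst h
    refine hasDerivWithinAt_Ici_of_tendsto_deriv (s := Ioi x)
      (fun y hy => (hf y hy).differentiableAt.differentiableWithinAt)
      hc.continuousWithinAt self_mem_nhdsWithin ?_
    refine tendsto_const_nhds.congr' ?_
    filter_upwards [self_mem_nhdsWithin] with y hy
    exact (hf y hy).deriv.symm

lemma ode_asymp (u u1 q : ℝ → ℝ) (hu1 : ∀ t, HasDerivAt u (u1 t) t)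
    (hu2 : ∀ t, HasDerivAt u1 (q t ^ 2 * u t) t) (hu : ∀ t, 0 < u t)
    (t0 : ℝ) (hpos : 0 < u1 t0) (α : ℝ) (hq : ∀ t, t0 < t → q t = α) :
    (α ≠ 0 → ∃ c C : ℝ, 0 < c ∧ c ≤ C ∧ ∀ t, t0 < t →
      c * Real.exp (|α| * t) ≤ u t ∧ u t ≤ C * Real.exp (|α| * t)) ∧
    (α = 0 → ∃ c C : ℝ, 0 < c ∧ c ≤ C ∧ ∀ t, t0 < t →
      c * (1 + |t|) ≤ u t ∧ u t ≤ C * (1 + |t|)) := by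
  have huc : Continuous u := continuous_iff_continuousAt.2 fun t => (hu1 t).continuousAt
  have hu1c : Continuous u1 := continuous_iff_continuousAt.2 fun t => (hu2 t).continuousAt
  have h0 := hu t0
  constructor
  · intro hα
    have ha : 0 < |α| := abs_pos.2 hα
    have hsq : |α| ^ 2 = α ^ 2 := sq_abs α
    generalize |α| = a at ha hsq
    -- P = (u1 + a u) e^{-a t}, Q = (u1 - a u) e^{a t}
    have hexp : ∀ k t : ℝ, HasDerivAt (fun t => Real.exp (k * t)) (k * Real.exp (k * t)) t := by
      intro k t
      have := ((hasDerivAt_id t).const_mul k).exp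
      refine this.congr_deriv ?_
      simp; ring
    have hP := const_Ici (fun t => (u1 t + a * u t) * Real.exp (-a * t)) t0 (by fun_prop) (by
      intro t ht
      have := ((hu2 t).add ((hu1 t).const_mul a)).mul (hexp (-a) t)
      refine this.congr_deriv ?_
      simp only [Pi.add_apply]
      rw [hq t ht, ← hsq]; ring)
    have hQ := const_Ici (fun t => (u1 t - a * u t) * Real.exp (a * t)) t0 (by fun_prop) (by
      intro t ht
      have := ((hu2 t).sub ((hu1 t).const_mul a)).mul (hexp a t)
      refine this.congr_deriv ?_
      simp only [Pi.sub_apply]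
      rw [hq t ht, ← hsq]; ring)
    beta_reduce at hP hQ
    set P := (u1 t0 + a * u t0) * Real.exp (-a * t0)
    set Q := (u1 t0 - a * u t0) * Real.exp (a * t0)
    have hPpos : 0 < P := by positivity
    have ee : ∀ t, Real.exp (a * t) * Real.exp (-a * t) = 1 := fun t => by
      rw [← Real.exp_add]; simp
    -- u e^{-a t} = (P - Q e^{-2 a t}) / (2 a)
    have hform : ∀ t, t0 ≤ t → 2 * a * u t = (P - Q * (Real.exp (-a * t)) ^ 2) * Real.exp (a * t) := by
      intro t ht
      rw [← hP t ht, ← hQ t ht]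
      linear_combination (-(u1 t + a * u t) + (u1 t - a * u t) * (Real.exp (a * t) * Real.exp (-a * t) + 1)) * ee t
    set E0 := (Real.exp (-a * t0)) ^ 2 with hE0
    have hE : ∀ t, t0 < t → (Real.exp (-a * t)) ^ 2 ≤ E0 := by
      intro t ht
      have : Real.exp (-a * t) ≤ Real.exp (-a * t0) := Real.exp_le_exp.2 (by nlinarith)
      rw [hE0]; gcongr
    have hm0 : 0 < P - Q * E0 := by
      have h1 := hform t0 le_rfl
      have h2 : 0 < (P - Q * E0) * Real.exp (a * t0) := by rw [← h1]; positivity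
      exact pos_of_mul_pos_left h2 (Real.exp_pos _).le
    have hE0p : 0 < E0 := by positivity
    refine ⟨min P (P - Q * E0) / (2 * a), (P + |Q| * E0) / (2 * a), ?_, ?_, ?_⟩
    · have := lt_min hPpos hm0
      positivity
    · have : min P (P - Q * E0) ≤ P + |Q| * E0 :=
        (min_le_left _ _).trans (le_add_of_nonneg_right (by positivity))
      gcongr
    · intro t ht
      have hu' : u t = (P - Q * (Real.exp (-a * t)) ^ 2) / (2 * a) * Real.exp (a * t) := by
        have := hform t ht.le
        rw [div_mul_eq_mul_div, ← this]
        field_simp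
      have hx := hE t ht
      have hx0 : 0 < (Real.exp (-a * t)) ^ 2 := by positivity
      rw [hu']
      generalize (Real.exp (-a * t)) ^ 2 = X at hx hx0
      constructor
      · have : min P (P - Q * E0) ≤ P - Q * X := by
          rcases le_total Q 0 with h | h
          · exact (min_le_left _ _).trans (by nlinarith)
          · exact (min_le_right _ _).trans (by nlinarith)
        gcongr
      · have : P - Q * X ≤ P + |Q| * E0 := by
          have := neg_abs_le Q
          have := abs_nonneg Q
          nlinarith
        gcongr
  · intro hα
    have hk := const_Ici u1 t0 hu1c (fun t ht => by
      have := hu2 t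
      rw [hq t ht, hα] at this
      simpa using this)
    set κ := u1 t0
    have hl := const_Ici (fun t => u t - κ * t) t0 (by fun_prop) (fun t ht => by
      have := (hu1 t).sub ((hasDerivAt_id t).const_mul κ)
      refine this.congr_deriv ?_
      rw [hk t ht.le]; simp)
    beta_reduce at hl
    have hu0 := h0
    have hA := abs_nonneg t0
    refine ⟨min κ (u t0 / (1 + |t0|)), u t0 + κ + κ * |t0|, lt_min hpos (by positivity), ?_, ?_⟩
    · refine (min_le_left _ _).trans ?_
      nlinarith [mul_nonneg hpos.le hA]
    · intro t ht
      have e : u t = u t0 + κ * (t - t0) := by linarith [hl t ht.le]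
      rw [e]
      have hT := abs_nonneg t
      constructor
      · have h1 : 1 + |t| ≤ (1 + |t0|) + (t - t0) := by
          have := abs_sub_abs_le_abs_sub t t0
          rw [abs_of_pos (sub_pos.2 ht)] at this
          linarith
        have hm : 0 < min κ (u t0 / (1 + |t0|)) := lt_min hpos (by positivity)
        calc _ ≤ min κ (u t0 / (1 + |t0|)) * ((1 + |t0|) + (t - t0)) := by gcongr
          _ = min κ (u t0 / (1 + |t0|)) * (1 + |t0|) + min κ (u t0 / (1 + |t0|)) * (t - t0) := by ring
          _ ≤ (u t0 / (1 + |t0|)) * (1 + |t0|) + κ * (t - t0) := by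
            have : 0 ≤ t - t0 := by linarith
            gcongr
            · exact min_le_right _ _
            · exact min_le_left _ _
          _ = _ := by field_simp
      · have h1 := le_abs_self t
        have h2 := neg_abs_le t0
        nlinarith [mul_nonneg hpos.le hA, mul_nonneg hpos.le hT, mul_nonneg hu0.le hT,
          mul_nonneg (mul_nonneg hpos.le hA) hT]

lemma radial_ode (b : ℝ → ℝ) (h : E2 → ℝ) (hc : ContDiff ℝ 2 h) (hr : ∃ g : ℝ → ℝ, ∀ x, h x = g ‖x‖)
    (heq : ∀ x : E2, x ≠ 0 → schrOp b h x = 0) :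
    ∃ u u1 : ℝ → ℝ, (∀ x : E2, x ≠ 0 → h x = u (Real.log ‖x‖)) ∧
      (∀ t, u t = h (Real.exp t • EuclideanSpace.single 0 1)) ∧
      (∀ t, HasDerivAt u (u1 t) t) ∧
      (∀ t, HasDerivAt u1 (b (Real.exp t) ^ 2 * u t) t) ∧ Tendsto u1 atBot (nhds 0) := by
  obtain ⟨g, hg⟩ := hr
  set e1 : E2 := EuclideanSpace.single 0 1 with he1
  have hn : ‖e1‖ = 1 := by simp [he1]
  have hnr : ∀ r : ℝ, 0 ≤ r → ‖r • e1‖ = r := fun r hr => by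
    rw [norm_smul, hn, Real.norm_eq_abs, abs_of_nonneg hr, mul_one]
  set G : ℝ → ℝ := fun ρ => h (Real.sqrt ρ • e1) with hG
  have hhG : h = fun x => G (‖x‖ ^ 2) := by
    ext x
    simp only [hG]
    rw [hg, hg (_ • e1), hnr _ (Real.sqrt_nonneg _), Real.sqrt_sq (norm_nonneg x)]
  have hGd : ContDiffOn ℝ (1 + 1) G (Ioi 0) := by
    rw [one_add_one_eq_two]
    apply hc.comp_contDiffOn
    have hs : ContDiffOn ℝ 2 (fun ρ : ℝ => Real.sqrt ρ) (Ioi 0) :=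
      fun x hx => (Real.contDiffAt_sqrt (ne_of_gt hx)).contDiffWithinAt
    exact hs.smul contDiffOn_const
  rw [contDiffOn_succ_iff_deriv_of_isOpen isOpen_Ioi] at hGd
  obtain ⟨hd1, -, hd2⟩ := hGd
  have hG1 : ∀ ρ, 0 < ρ → HasDerivAt G (deriv G ρ) ρ := fun ρ hρ =>
    (hd1.differentiableAt (Ioi_mem_nhds hρ)).hasDerivAt
  have hG2 : ∀ ρ, 0 < ρ → HasDerivAt (deriv G) (deriv (deriv G) ρ) ρ := fun ρ hρ =>
    ((hd2.differentiableOn one_ne_zero).differentiableAt (Ioi_mem_nhds hρ)).hasDerivAt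
  have hode : ∀ r, 0 < r → 4 * (r ^ 2 * deriv (deriv G) (r ^ 2) + deriv G (r ^ 2)) =
      b r ^ 2 / r ^ 2 * G (r ^ 2) := by
    intro r hr
    have hne : r • e1 ≠ 0 := by
      rw [← norm_ne_zero_iff, hnr r hr.le]; exact hr.ne'
    have := heq (r • e1) hne
    rw [schrOp, hhG] at this
    have hr2 : (0:ℝ) < r ^ 2 := by positivity
    rw [lap_radial G (deriv G) (deriv (deriv G) (r ^ 2)) (r • e1)
      (by rw [hnr r hr.le]; filter_upwards [Ioi_mem_nhds hr2] with ρ hρ using hG1 ρ hρ)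
      (by rw [hnr r hr.le]; exact hG2 _ hr2), hnr r hr.le] at this
    beta_reduce at this
    rw [hnr r hr.le] at this
    linarith
  have hE : ∀ t : ℝ, HasDerivAt (fun t => Real.exp t ^ 2) (2 * Real.exp t ^ 2) t := fun t => by
    have := (Real.hasDerivAt_exp t).pow 2
    refine this.congr_deriv ?_
    simp; ring
  have hEp : ∀ t : ℝ, 0 < Real.exp t ^ 2 := fun t => by positivity
  have hu : ∀ t, G (Real.exp t ^ 2) = h (Real.exp t • e1) := fun t => by
    simp only [hG]; rw [Real.sqrt_sq (Real.exp_pos t).le]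
  have hu1 : ∀ t, HasDerivAt (fun t => G (Real.exp t ^ 2)) (deriv G (Real.exp t ^ 2) * (2 * Real.exp t ^ 2)) t :=
    fun t => HasDerivAt.comp (h₂ := G) t (hG1 _ (hEp t)) (hE t)
  refine ⟨fun t => G (Real.exp t ^ 2), fun t => deriv G (Real.exp t ^ 2) * (2 * Real.exp t ^ 2), ?_, hu, hu1, ?_, ?_⟩
  · intro x hx
    simp only
    rw [Real.exp_log (norm_pos_iff.2 hx)]
    exact congrFun hhG x
  · intro t
    have := ((hG2 _ (hEp t)).comp t (hE t)).mul ((hE t).const_mul 2)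
    refine this.congr_deriv ?_
    have h2 := hode _ (Real.exp_pos t)
    have h3 : b (Real.exp t) ^ 2 * G (Real.exp t ^ 2) =
      Real.exp t ^ 2 * (b (Real.exp t) ^ 2 / Real.exp t ^ 2 * G (Real.exp t ^ 2)) := by field_simp
    rw [h3, ← h2]
    simp only [Function.comp]
    ring
  · have hfd : ∀ t, deriv G (Real.exp t ^ 2) * (2 * Real.exp t ^ 2) =
        fderiv ℝ h (Real.exp t • e1) (Real.exp t • e1) := by
      intro t
      have h1 := (hc.differentiable two_ne_zero (Real.exp t • e1)).hasFDerivAt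
      have h2 := h1.comp_hasDerivAt t ((Real.hasDerivAt_exp t).smul_const e1)
      have h3 := hu1 t
      rw [show (fun t => G (Real.exp t ^ 2)) = h ∘ fun t => Real.exp t • e1 from funext hu] at h3
      exact h3.unique h2
    rw [funext hfd]
    have hcf : Continuous fun x : E2 => fderiv ℝ h x x :=
      (hc.continuous_fderiv two_ne_zero).clm_apply continuous_id
    have h4 : Tendsto (fun t => Real.exp t • e1) atBot (nhds 0) := by
      have := Real.tendsto_exp_atBot.smul_const e1
      simpa using this
    have := (hcf.tendsto 0).comp h4
    rw [map_zero] at this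
    exact this

/-- ground state of the auxiliary operator 𝒜 = −Δ + b(|x|)²/|x|²
and its asymptotics for |x| > R. -/
theorem stmt0 (B : ℝ → ℝ) (R : ℝ) (hR : 0 < R) (hBcont : Continuous B)
    (hBsupp : Function.support B ⊆ Icc 0 R)
    (b : ℝ → ℝ) (hb : ∀ r, b r = fluxFun B r)
    (α : ℝ) (hα : ∀ r, R < r → b r = α)
    (hbne : b ≠ 0) :
    (∃ h : E2 → ℝ, ContDiff ℝ 2 h ∧ (∀ x, 0 < h x) ∧ (∃ g : ℝ → ℝ, ∀ x, h x = g ‖x‖) ∧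
        ∀ x : E2, x ≠ 0 → schrOp b h x = 0) ∧
    (∀ h : E2 → ℝ, ContDiff ℝ 2 h → (∀ x, 0 < h x) → (∃ g : ℝ → ℝ, ∀ x, h x = g ‖x‖) →
        (∀ x : E2, x ≠ 0 → schrOp b h x = 0) →
        (α ≠ 0 → ∃ c C : ℝ, 0 < c ∧ c ≤ C ∧ ∀ x : E2, R < ‖x‖ →
            c * ‖x‖ ^ |α| ≤ h x ∧ h x ≤ C * ‖x‖ ^ |α|) ∧
        (α = 0 → ∃ c C : ℝ, 0 < c ∧ c ≤ C ∧ ∀ x : E2, R < ‖x‖ →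
            c * (1 + |Real.log ‖x‖|) ≤ h x ∧ h x ≤ C * (1 + |Real.log ‖x‖|))) := by
  have hbc : Continuous b := by
    have : b = fun r => r ^ 2 * ∫ τ in (0:ℝ)..1, τ * B (r * τ) := by
      ext r; rw [hb, flux_beta]
    rw [this]
    exact (continuous_pow 2).mul (beta_cont hBcont)
  have hbneg : ∀ r, r ≤ 0 → b r = 0 := by
    intro r hr
    rw [hb, fluxFun]
    have : EqOn (fun s => B s * s) (fun _ => (0:ℝ)) (uIcc 0 r) := by
      intro s hs
      rw [uIcc_of_ge hr] at hs
      rcases hs.2.eq_or_lt with h | h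
      · simp [h]
      · have : B s = 0 := by
          by_contra hne
          exact absurd (hBsupp hne).1 (not_le.2 h)
        simp [this]
    rw [intervalIntegral.integral_congr this]
    simp
  have hex : ∃ r, 0 < r ∧ r < R ∧ b r ≠ 0 := by
    by_contra hcon
    push Not at hcon
    have hIcc : ∀ r ∈ Icc 0 R, b r = 0 := by
      have hcl : closure (Ioo 0 R) ⊆ {r | b r = 0} :=
        closure_minimal (fun r hr => hcon r hr.1 hr.2) (isClosed_eq hbc continuous_const)
      rw [closure_Ioo hR.ne] at hcl
      exact hcl
    have hαR : b R = α := by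
      have hcl : closure (Ioi R) ⊆ {r | b r = α} :=
        closure_minimal (fun r hr => hα r hr) (isClosed_eq hbc continuous_const)
      rw [closure_Ioi] at hcl
      exact hcl self_mem_Ici
    apply hbne
    ext r
    rcases le_or_gt r 0 with h | h
    · exact hbneg r h
    rcases le_or_gt r R with h' | h'
    · exact hIcc r ⟨h.le, h'⟩
    · rw [hα r h', ← hαR]
      exact hIcc R ⟨hR.le, le_rfl⟩
  refine ⟨part_one B R hBcont hBsupp b hb, fun h hc hpos hr heq => ?_⟩
  obtain ⟨u, u1, hhu, hu, hu1, hu2, hlim⟩ := radial_ode b h hc hr heq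
  have hup : ∀ t, 0 < u t := fun t => by rw [hu]; exact hpos _
  have hκ : 0 < u1 (Real.log R) := by
    apply nonneg_tools u u1 (fun t => b (Real.exp t)) hu1 hu2 hup hlim
    obtain ⟨r, h0, h1, h2⟩ := hex
    exact ⟨Real.log r, Real.log_lt_log h0 h1, by rwa [Real.exp_log h0]⟩
  obtain ⟨hA, hZ⟩ := ode_asymp u u1 (fun t => b (Real.exp t)) hu1 hu2 hup (Real.log R) hκ α
    (fun t ht => hα _ ((Real.log_lt_iff_lt_exp hR).1 ht))
  constructor
  · intro h0
    obtain ⟨c, C, hc0, hcC, hb'⟩ := hA h0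
    refine ⟨c, C, hc0, hcC, fun x hx => ?_⟩
    have hx0 : 0 < ‖x‖ := hR.trans hx
    rw [hhu x (norm_pos_iff.1 hx0), Real.rpow_def_of_pos hx0, mul_comm (Real.log _)]
    exact hb' _ (Real.log_lt_log hR hx)
  · intro h0
    obtain ⟨c, C, hc0, hcC, hb'⟩ := hZ h0
    refine ⟨c, C, hc0, hcC, fun x hx => ?_⟩
    have hx0 : 0 < ‖x‖ := hR.trans hx
    rw [hhu x (norm_pos_iff.1 hx0)]
    exact hb' _ (Real.log_lt_log hR hx)
end
end

section
/- Let b:[0,∞)→ℝ be continuous and bounded, and let h∈C²((0,∞)) be a positive function satisfying r(r h′(r))′ = b(r)² h(r) for all r>0, with lim_{r→0⁺} r h′(r) = 0. Then h′(r) ≥ 0 for all r>0, i.e. h is nondecreasing on (0,∞). -/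
noncomputable section

open Filter Set

/-- a positive C² solution of r(rh′)′ = b²h with rh′ → 0 at the origin
is nondecreasing on (0,∞). -/
theorem stmt15 (b : ℝ → ℝ) (hb : Continuous b) (hbd : ∃ M : ℝ, ∀ r, |b r| ≤ M)
    (h : ℝ → ℝ) (hreg : ContDiffOn ℝ 2 h (Ioi 0))
    (hpos : ∀ r ∈ Ioi (0 : ℝ), 0 < h r)
    (hode : ∀ r ∈ Ioi (0 : ℝ), r * deriv (fun s => s * deriv h s) r = (b r) ^ 2 * h r)
    (hlim : Tendsto (fun r => r * deriv h r) (nhdsWithin 0 (Ioi 0)) (nhds 0)) :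
    ∀ r ∈ Ioi (0 : ℝ), 0 ≤ deriv h r := by
  have hd : DifferentiableOn ℝ (deriv h) (Ioi 0) :=
    (hreg.deriv_of_isOpen isOpen_Ioi (m := 1) (by norm_num)).differentiableOn (by norm_num)
  have hg : DifferentiableOn ℝ (fun s => s * deriv h s) (Ioi 0) := differentiableOn_id.mul hd
  have hmono : MonotoneOn (fun s => s * deriv h s) (Ioi (0 : ℝ)) := by
    apply monotoneOn_of_deriv_nonneg (convex_Ioi 0) hg.continuousOn
    · rw [interior_Ioi]; exact hg
    · rw [interior_Ioi]
      intro x hx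
      have h1 := hode x hx
      have h2 : 0 ≤ x * deriv (fun s => s * deriv h s) x := by
        rw [h1]; exact mul_nonneg (sq_nonneg _) (hpos x hx).le
      exact nonneg_of_mul_nonneg_right h2 hx
  intro r hr
  have hr0 : (0 : ℝ) < r := hr
  have key : 0 ≤ r * deriv h r := by
    refine le_of_tendsto hlim ?_
    filter_upwards [Ioo_mem_nhdsGT hr0] with s hs
    exact hmono hs.1 hr hs.2.le
  exact nonneg_of_mul_nonneg_right key hr0
end
end
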